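/- arXiv:2102.03221 — 2 statements merged into one kernel-verified Lean document; each statement's English description precedes it below -/
import Mathlib

section
/- Let P and Q be real polynomial functions on ℝ³ that are harmonic (ΔP = 0 and ΔQ = 0 for the ambient Laplacian Δ = Σ_i ∂²/∂x_i²) and homogeneous of degrees m and n respectively, with m ≠ n. Then for every k ∈ {1,2,3}, ∫_{S²} x_k ⟨x, ∇P(x) × ∇Q(x)⟩ dS = 0. -/
open MeasureTheory Matrix

noncomputable section

/-- Euclidean 3-space. -/
abbrev E3 := EuclideanSpace ℝ (Fin 3)

/-- The Euclidean inner product on coordinate vectors. -/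
def dot3 (a b : Fin 3 → ℝ) : ℝ := ∑ i, a i * b i

/-- The cross product in ℝ³. -/
def cross3 (a b : Fin 3 → ℝ) : Fin 3 → ℝ :=
  ![a 1 * b 2 - a 2 * b 1, a 2 * b 0 - a 0 * b 2, a 0 * b 1 - a 1 * b 0]

/-- Standard basis vectors of E3. -/
def e3 (i : Fin 3) : E3 := EuclideanSpace.single i 1

/-- The ambient gradient of `u : ℝ³ → ℝ` (as a coordinate vector). -/
def grad3 (u : E3 → ℝ) (x : E3) : Fin 3 → ℝ := fun i => fderiv ℝ u x (e3 i)

/-- The ambient Hessian matrix of `u : ℝ³ → ℝ`. -/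
def hess3 (u : E3 → ℝ) (x : E3) : Matrix (Fin 3) (Fin 3) ℝ :=
  Matrix.of fun i j => iteratedFDeriv ℝ 2 u x ![e3 i, e3 j]

/-- The ambient Euclidean Laplacian Δu = Σᵢ ∂²u/∂xᵢ². -/
def lap3 (u : E3 → ℝ) : E3 → ℝ := fun x => ∑ i, hess3 u x i i

/-- The orthogonal projection P(x) = I - x xᵀ onto the tangent plane of S² at x. -/
def proj3 (x : E3) : Matrix (Fin 3) (Fin 3) ℝ := 1 - Matrix.of fun i j => x i * x j

/-- The projected ambient Hessian H_u(x) = P(x) (D²u)(x) P(x), realizing the intrinsic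
Hessian on S² of the restriction of a degree-0 homogeneous function. -/
def hessS (u : E3 → ℝ) (x : E3) : Matrix (Fin 3) (Fin 3) ℝ := proj3 x * hess3 u x * proj3 x

/-- The matrix of the linear map `w ↦ x × w` on ℝ³. -/
def crossMat (x : E3) : Matrix (Fin 3) (Fin 3) ℝ :=
  !![0, -x 2, x 1; x 2, 0, -x 0; -x 1, x 0, 0]

/-- `u` is (positively) homogeneous of degree 0 away from the origin. -/
def Homog0 (u : E3 → ℝ) : Prop := ∀ c : ℝ, 0 < c → ∀ x : E3, x ≠ 0 → u (c • x) = u x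

section

open MvPolynomial

/-- The infinitesimal rotation `xᵢ ∂ⱼ - xⱼ ∂ᵢ` as a derivation of the polynomial ring. -/
def angularDeriv (i j : Fin 3) :
    Derivation ℝ (MvPolynomial (Fin 3) ℝ) (MvPolynomial (Fin 3) ℝ) :=
  (X i : MvPolynomial (Fin 3) ℝ) • pderiv j - (X j : MvPolynomial (Fin 3) ℝ) • pderiv i

lemma angularDeriv_apply (i j : Fin 3) (f : MvPolynomial (Fin 3) ℝ) :
    angularDeriv i j f = X i * pderiv j f - X j * pderiv i f := rfl

/-- Partial derivatives of polynomials commute. -/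
lemma pderiv_pderiv_comm (i j : Fin 3) (f : MvPolynomial (Fin 3) ℝ) :
    pderiv i (pderiv j f) = pderiv j (pderiv i f) := by
  have h : ⁅pderiv (R := ℝ) i, pderiv (R := ℝ) j⁆ = 0 := by
    refine derivation_ext fun l => ?_
    rw [Derivation.commutator_apply, pderiv_X, pderiv_X]
    fin_cases i <;> fin_cases j <;> fin_cases l <;> simp
  have := congrArg (fun D => D f) h
  rwa [Derivation.commutator_apply, Derivation.zero_apply, sub_eq_zero] at this

/-- The commutation relations of the infinitesimal rotations. -/
lemma angularDeriv_comm (k : Fin 3) (f : MvPolynomial (Fin 3) ℝ) :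
    angularDeriv (k + 1) (k + 2) (angularDeriv (k + 2) k f) =
      angularDeriv (k + 2) k (angularDeriv (k + 1) (k + 2) f) - angularDeriv k (k + 1) f := by
  have h₁ := pderiv_pderiv_comm k (k + 1) f
  have h₂ := pderiv_pderiv_comm k (k + 2) f
  have h₃ := pderiv_pderiv_comm (k + 1) (k + 2) f
  fin_cases k <;>
  · simp [angularDeriv_apply] at h₁ h₂ h₃ ⊢
    rw [h₁, h₂, h₃]
    ring

/-- The Casimir operator `∑ L²` of the infinitesimal rotations. -/
def casimir (f : MvPolynomial (Fin 3) ℝ) : MvPolynomial (Fin 3) ℝ :=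
  ∑ k : Fin 3, angularDeriv (k + 1) (k + 2) (angularDeriv (k + 1) (k + 2) f)

lemma casimir_angularDeriv (k : Fin 3) (f : MvPolynomial (Fin 3) ℝ) :
    casimir (angularDeriv (k + 1) (k + 2) f) = angularDeriv (k + 1) (k + 2) (casimir f) := by
  have h := angularDeriv_comm
  have h₀ := fun f => h 0 f
  have h₁ := fun f => h 1 f
  have h₂ := fun f => h 2 f
  simp only [Fin.isValue, zero_add, Fin.reduceAdd] at h₀ h₁ h₂
  unfold casimir
  fin_cases k <;>
  · simp [Fin.sum_univ_three]
    simp only [h₀, h₁, h₂, map_sub]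
    ring

/-- A harmonic homogeneous polynomial is an eigenvector of the Casimir operator. -/
lemma casimir_of_harmonic {P : MvPolynomial (Fin 3) ℝ} {m : ℕ} (hm : P.IsHomogeneous m)
    (hP : ∑ i : Fin 3, pderiv i (pderiv i P) = 0) :
    casimir P = -(m * (m + 1) : ℝ) • P := by
  have hE := hm.sum_X_mul_pderiv
  have hE' : ∀ l, pderiv l (∑ i : Fin 3, X i * pderiv i P) = (m : ℝ) • pderiv l P := by
    intro l
    rw [hE, ← Nat.cast_smul_eq_nsmul ℝ, Derivation.map_smul]
  have h0 := hE' 0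
  have h1 := hE' 1
  have h2 := hE' 2
  have h10 := pderiv_pderiv_comm 1 0 P
  have h20 := pderiv_pderiv_comm 2 0 P
  have h21 := pderiv_pderiv_comm 2 1 P
  rw [← Nat.cast_smul_eq_nsmul ℝ] at hE
  simp [casimir, Fin.sum_univ_three, angularDeriv_apply, pderiv_X,
    smul_eq_C_mul] at hE h0 h1 h2 hP ⊢
  simp only [h10, h20, h21] at h0 h1 h2 ⊢
  linear_combination (X 0 ^ 2 + X 1 ^ 2 + X 2 ^ 2) * hP - X 0 * h0 - X 1 * h1 - X 2 * h2
    - ((m : MvPolynomial (Fin 3) ℝ) + 1) * hE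

/-- The bracket `⟨x, ∇F × ∇G⟩` of two polynomials. -/
def polyBracket (F G : MvPolynomial (Fin 3) ℝ) : MvPolynomial (Fin 3) ℝ :=
  ∑ k : Fin 3, X k * (pderiv (k + 1) F * pderiv (k + 2) G - pderiv (k + 2) F * pderiv (k + 1) G)

/-- The bracket is a sum of rotational derivatives, hence a divergence along the sphere. -/
lemma polyBracket_eq_sum_angularDeriv (F G : MvPolynomial (Fin 3) ℝ) :
    polyBracket F G = ∑ k : Fin 3, angularDeriv (k + 1) (k + 2) (F * pderiv k G) := by
  have h10 := pderiv_pderiv_comm 1 0 G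
  have h20 := pderiv_pderiv_comm 2 0 G
  have h21 := pderiv_pderiv_comm 2 1 G
  simp [polyBracket, Fin.sum_univ_three, angularDeriv_apply]
  rw [h10, h20, h21]
  ring

lemma X_mul_polyBracket (k : Fin 3) (F G : MvPolynomial (Fin 3) ℝ) :
    X k * polyBracket F G = polyBracket (X k * F) G + F * angularDeriv (k + 1) (k + 2) G := by
  fin_cases k <;>
  · simp [polyBracket, Fin.sum_univ_three, angularDeriv_apply, pderiv_X, Pi.single_apply]
    ring

/-- A functional that kills all rotational derivatives kills `x_k ⟨x, ∇P × ∇Q⟩` for harmonic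
homogeneous polynomials of different degrees. -/
lemma map_X_mul_polyBracket_eq_zero (I : MvPolynomial (Fin 3) ℝ →ₗ[ℝ] ℝ)
    (hI : ∀ k f, I (angularDeriv (k + 1) (k + 2) f) = 0)
    {P Q : MvPolynomial (Fin 3) ℝ} {m n : ℕ}
    (hm : P.IsHomogeneous m) (hn : Q.IsHomogeneous n) (hmn : m ≠ n)
    (hP : ∑ i : Fin 3, pderiv i (pderiv i P) = 0)
    (hQ : ∑ i : Fin 3, pderiv i (pderiv i Q) = 0) (k : Fin 3) :
    I (X k * polyBracket P Q) = 0 := by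
  have parts : ∀ l f g, I (angularDeriv (l + 1) (l + 2) f * g) =
      -I (f * angularDeriv (l + 1) (l + 2) g) := by
    intro l f g
    have h := hI l (f * g)
    rw [Derivation.leibniz, smul_eq_mul, smul_eq_mul, map_add, mul_comm g] at h
    linarith
  have symm : ∀ f g, I (casimir f * g) = I (f * casimir g) := by
    intro f g
    simp only [casimir, Finset.sum_mul, Finset.mul_sum, map_sum, parts, neg_neg]
  rw [X_mul_polyBracket, map_add, polyBracket_eq_sum_angularDeriv, map_sum,
    Finset.sum_eq_zero fun l _ => hI l _, zero_add]
  have h := symm P (angularDeriv (k + 1) (k + 2) Q)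
  rw [casimir_angularDeriv, casimir_of_harmonic hm hP, casimir_of_harmonic hn hQ,
    Derivation.map_smul, smul_mul_assoc, mul_smul_comm, map_smul, map_smul, smul_eq_mul, smul_eq_mul] at h
  have hne : (m * (m + 1) : ℝ) ≠ n * (n + 1) := by
    intro h'
    have h'' : ((m : ℝ) - n) * (m + n + 1) = 0 := by linear_combination h'
    rcases mul_eq_zero.1 h'' with h₁ | h₁
    · exact hmn (by exact_mod_cast sub_eq_zero.1 h₁)
    · have : (0 : ℝ) < m + n + 1 := by positivity
      exact this.ne' h₁
  have h' : ((m * (m + 1) : ℝ) - n * (n + 1)) * I (P * angularDeriv (k + 1) (k + 2) Q) = 0 := by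
    linear_combination -h
  exact (mul_eq_zero.1 h').resolve_left (sub_ne_zero.2 hne)

/-- Chain rule for a polynomial along an integral curve of a derivation. -/
lemma hasDerivAt_eval_of_derivation {σ : Type*}
    (D : Derivation ℝ (MvPolynomial σ ℝ) (MvPolynomial σ ℝ))
    {γ : ℝ → σ → ℝ} {t : ℝ} (hγ : ∀ l, HasDerivAt (fun s => γ s l) (eval (γ t) (D (X l))) t)
    (f : MvPolynomial σ ℝ) :
    HasDerivAt (fun s => eval (γ s) f) (eval (γ t) (D f)) t := by
  induction f using MvPolynomial.induction_on with
  | C a => simpa using hasDerivAt_const t a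
  | add p q hp hq =>
    simp only [map_add]
    exact hp.add hq
  | mul_X p l hp =>
    simp only [map_mul, eval_X, Derivation.leibniz, smul_eq_mul, map_add]
    exact (hp.mul (hγ l)).congr_deriv (by ring)

lemma continuous_eval_coord (f : MvPolynomial (Fin 3) ℝ) :
    Continuous fun x : E3 => eval (fun l => x l) f :=
  (MvPolynomial.continuous_eval f).comp (by fun_prop)

end

/-- The unit sphere has finite two-dimensional Hausdorff measure. -/
lemma hausdorffMeasure_sphere_lt_top : μH[2] (Metric.sphere (0 : E3) 1) < ⊤ := by
  let g : (Fin 2 → ℝ) → E3 := fun v =>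
    !₂[Real.sin (v 0) * Real.cos (v 1), Real.sin (v 0) * Real.sin (v 1), Real.cos (v 0)]
  have hg : ContDiff ℝ 1 g := by
    rw [contDiff_euclidean]
    intro i
    fin_cases i <;> simp [g] <;> fun_prop
  obtain ⟨K, hK⟩ := (hg.locallyLipschitz.locallyLipschitzOn
    (s := Metric.closedBall 0 Real.pi)).exists_lipschitzOnWith_of_compact
    (isCompact_closedBall _ _)
  have hsub : Metric.sphere (0 : E3) 1 ⊆ g '' Metric.closedBall 0 Real.pi := by
    intro x hx
    have hx' : x 0 ^ 2 + x 1 ^ 2 + x 2 ^ 2 = 1 := by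
      have := EuclideanSpace.real_norm_sq_eq x
      rw [mem_sphere_zero_iff_norm.1 hx, Fin.sum_univ_three] at this
      linarith
    let w : ℂ := ⟨x 0, x 1⟩
    have hw : Real.sin (Real.arccos (x 2)) = ‖w‖ := by
      rw [Real.sin_arccos, Complex.norm_def, Complex.normSq_apply]
      congr 1
      simp only [w]
      linarith
    refine ⟨![Real.arccos (x 2), Complex.arg w], ?_, ?_⟩
    · rw [mem_closedBall_zero_iff, pi_norm_le_iff_of_nonneg Real.pi_pos.le]
      intro i
      fin_cases i
      · simpa [abs_of_nonneg (Real.arccos_nonneg _)] using Real.arccos_le_pi (x 2)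
      · simpa using Complex.abs_arg_le_pi w
    · ext i
      fin_cases i
      · simp [g, hw, w]
      · simp [g, hw, w]
      · simpa [g] using Real.cos_arccos (by nlinarith) (by nlinarith)
  refine (measure_mono hsub).trans_lt ((hK.hausdorffMeasure_image_le (by norm_num)).trans_lt ?_)
  have h2 : (μH[2] : Measure (Fin 2 → ℝ)) = volume := by
    simpa using hausdorffMeasure_pi_real (ι := Fin 2)
  rw [h2]
  exact ENNReal.mul_lt_top (ENNReal.rpow_lt_top_of_nonneg (by norm_num) (by simp))
    measure_closedBall_lt_top

/-- The rotation by angle `t` in the coordinate plane orthogonal to the `k`-th axis. -/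
def rotationMap (k : Fin 3) (t : ℝ) : E3 →ₗᵢ[ℝ] E3 where
  toFun x := WithLp.toLp 2 fun l =>
    if l = k + 1 then Real.cos t * x (k + 1) - Real.sin t * x (k + 2)
    else if l = k + 2 then Real.sin t * x (k + 1) + Real.cos t * x (k + 2) else x l
  map_add' x y := by
    ext l
    simp only [PiLp.add_apply]
    split_ifs <;> ring
  map_smul' c x := by
    ext l
    simp only [PiLp.smul_apply, smul_eq_mul, RingHom.id_apply]
    split_ifs <;> ring
  norm_map' x := by
    have h := Real.sin_sq_add_cos_sq t
    rw [← sq_eq_sq₀ (norm_nonneg _) (norm_nonneg _), EuclideanSpace.real_norm_sq_eq,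
      EuclideanSpace.real_norm_sq_eq, Fin.sum_univ_three, Fin.sum_univ_three]
    fin_cases k <;> simp
    · linear_combination (x 1 ^ 2 + x 2 ^ 2) * h
    · linear_combination (x 2 ^ 2 + x 0 ^ 2) * h
    · linear_combination (x 0 ^ 2 + x 1 ^ 2) * h

lemma rotationMap_apply (k : Fin 3) (t : ℝ) (x : E3) (l : Fin 3) :
    rotationMap k t x l =
      if l = k + 1 then Real.cos t * x (k + 1) - Real.sin t * x (k + 2)
      else if l = k + 2 then Real.sin t * x (k + 1) + Real.cos t * x (k + 2) else x l := rfl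

lemma rotationMap_zero (k : Fin 3) (x : E3) : rotationMap k 0 x = x := by
  ext l
  rw [rotationMap_apply]
  split_ifs with h₁ h₂
  · simp [h₁]
  · simp [h₂]
  · rfl

/-- Linear isometries preserve integrals over the unit sphere. -/
lemma integral_sphere_comp_linearIsometry (R : E3 →ₗᵢ[ℝ] E3) (f : E3 → ℝ) :
    ∫ x in Metric.sphere (0 : E3) 1, f (R x) ∂(μH[2]) =
      ∫ x in Metric.sphere (0 : E3) 1, f x ∂(μH[2]) := by
  let e := R.toLinearIsometryEquiv rfl
  have h := (e.toIsometryEquiv.measurePreserving_hausdorffMeasure 2).setIntegral_preimage_emb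
    e.toHomeomorph.measurableEmbedding f (Metric.sphere 0 1)
  rw [← h]
  have hpre : e.toIsometryEquiv ⁻¹' Metric.sphere (0 : E3) 1 = Metric.sphere 0 1 := by
    ext x
    simp
  rw [hpre]
  rfl

/-- The integral over the unit sphere of a rotational derivative vanishes. -/
lemma integral_sphere_angularDeriv (k : Fin 3) (f : MvPolynomial (Fin 3) ℝ) :
    ∫ x in Metric.sphere (0 : E3) 1,
      MvPolynomial.eval (fun l => x l) (angularDeriv (k + 1) (k + 2) f) ∂(μH[2]) = 0 := by
  have : IsFiniteMeasure ((μH[2] : Measure E3).restrict (Metric.sphere 0 1)) :=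
    ⟨by simpa using hausdorffMeasure_sphere_lt_top⟩
  have hmeas : MeasurableSet (Metric.sphere (0 : E3) 1) := Metric.isClosed_sphere.measurableSet
  let D := angularDeriv (k + 1) (k + 2)
  have hcont : ∀ (p : MvPolynomial (Fin 3) ℝ) (t : ℝ),
      Continuous fun x : E3 => MvPolynomial.eval (fun l => rotationMap k t x l) p :=
    fun p t => (continuous_eval_coord p).comp (rotationMap k t).continuous
  have hbdd : ∀ p : MvPolynomial (Fin 3) ℝ, ∃ C, ∀ t, ∀ x ∈ Metric.sphere (0 : E3) 1,
      ‖MvPolynomial.eval (fun l => rotationMap k t x l) p‖ ≤ C := by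
    intro p
    obtain ⟨C, hC⟩ := (isCompact_sphere (0 : E3) 1).exists_bound_of_continuousOn
      (continuous_eval_coord p).continuousOn
    exact ⟨C, fun t x hx => hC _ (by simpa using hx)⟩
  obtain ⟨C, hC⟩ := hbdd (D f)
  obtain ⟨C', hC'⟩ := hbdd f
  have hder := (hasDerivAt_integral_of_dominated_loc_of_deriv_le
    (μ := (μH[2] : Measure E3).restrict (Metric.sphere 0 1)) (x₀ := (0 : ℝ))
    (F := fun t x => MvPolynomial.eval (fun l => rotationMap k t x l) f)
    (F' := fun t x => MvPolynomial.eval (fun l => rotationMap k t x l) (D f))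
    (bound := fun _ => C) Filter.univ_mem
    (.of_forall fun t => (hcont f t).aestronglyMeasurable)
    (.of_bound (hcont f 0).aestronglyMeasurable C'
      ((ae_restrict_mem hmeas).mono fun x hx => hC' 0 x hx))
    (hcont (D f) 0).aestronglyMeasurable
    ((ae_restrict_mem hmeas).mono fun x hx t _ => hC t x hx)
    (integrable_const C)
    (.of_forall fun x t _ => by
      refine hasDerivAt_eval_of_derivation D
        (γ := fun t l => rotationMap k t x l) (fun l => ?_) f
      have hc := Real.hasDerivAt_cos t
      have hs := Real.hasDerivAt_sin t
      have h₁ := (hc.mul_const (x (k + 1))).sub (hs.mul_const (x (k + 2)))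
      have h₂ := (hs.mul_const (x (k + 1))).add (hc.mul_const (x (k + 2)))
      have h₃ := hasDerivAt_const t (x k)
      simp only [D, angularDeriv_apply, rotationMap_apply, MvPolynomial.pderiv_X]
      fin_cases k <;> fin_cases l <;>
        simp at h₁ h₂ h₃ ⊢ <;>
        first
          | exact h₃
          | exact h₁.congr_deriv (by ring)
          | exact h₂.congr_deriv (by ring)))
  have hconst : (fun t => ∫ x in Metric.sphere (0 : E3) 1,
      MvPolynomial.eval (fun l => rotationMap k t x l) f ∂(μH[2])) =
      fun _ => ∫ x in Metric.sphere (0 : E3) 1, MvPolynomial.eval (fun l => x l) f ∂(μH[2]) :=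
    funext fun t => integral_sphere_comp_linearIsometry (rotationMap k t)
      fun x => MvPolynomial.eval (fun l => x l) f
  have h := hder.2
  rw [hconst] at h
  simpa only [rotationMap_zero] using h.unique (hasDerivAt_const _ _)

/-- Integration of polynomials over the unit sphere, as a linear functional. -/
def sphereIntegral : MvPolynomial (Fin 3) ℝ →ₗ[ℝ] ℝ where
  toFun f := ∫ x in Metric.sphere (0 : E3) 1, MvPolynomial.eval (fun l => x l) f ∂(μH[2])
  map_add' f g := by
    have hint : ∀ p : MvPolynomial (Fin 3) ℝ, IntegrableOn
        (fun x : E3 => MvPolynomial.eval (fun l => x l) p) (Metric.sphere 0 1) μH[2] := fun p =>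
      (continuous_eval_coord p).continuousOn.integrableOn_of_subset_isCompact
        (isCompact_sphere 0 1) Metric.isClosed_sphere.measurableSet subset_rfl
        hausdorffMeasure_sphere_lt_top.ne
    simp only [map_add]
    exact integral_add (hint f) (hint g)
  map_smul' c f := by
    simp only [MvPolynomial.smul_eval, RingHom.id_apply, smul_eq_mul]
    exact integral_const_mul _ _

/-- if P, Q are harmonic polynomials on ℝ³, homogeneous of distinct degrees
m ≠ n, then ∫_{S²} x_k ⟨x, ∇P × ∇Q⟩ dS = 0. -/
theorem integral_coord_bracket_different_modes (P Q : MvPolynomial (Fin 3) ℝ) (m n : ℕ)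
    (hm : P.IsHomogeneous m) (hn : Q.IsHomogeneous n) (hmn : m ≠ n)
    (hPharm : ∑ i : Fin 3, MvPolynomial.pderiv i (MvPolynomial.pderiv i P) = 0)
    (hQharm : ∑ i : Fin 3, MvPolynomial.pderiv i (MvPolynomial.pderiv i Q) = 0)
    (k : Fin 3) :
    ∫ x in Metric.sphere (0:E3) 1,
      x k * dot3 (fun i => x i)
        (cross3 (fun i => MvPolynomial.eval (fun j => x j) (MvPolynomial.pderiv i P))
                (fun i => MvPolynomial.eval (fun j => x j) (MvPolynomial.pderiv i Q)))
        ∂(μH[2]) = 0 := by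
  have h := map_X_mul_polyBracket_eq_zero sphereIntegral integral_sphere_angularDeriv
    hm hn hmn hPharm hQharm k
  refine Eq.trans (integral_congr_ae (.of_forall fun x => ?_)) h
  simp [polyBracket, dot3, cross3, Fin.sum_univ_three]
end
end

section
/- Let n = (n_{ij}) be a real symmetric traceless 3×3 matrix and let x ∈ S² (so |x| = 1). Then tr( ( 2 P(x) n P(x) − 2 (xᵀ n x) P(x) )² ) = 20 (xᵀ n x)² − 8 ( xᵀ n² x − (1/3) tr(n²) ) + (4/3) tr(n²), where P(x) = I − x xᵀ. (The matrix 2P n P − 2(xᵀ n x)P realizes the intrinsic Hessian ∇_A∇_B ñ on S² of the restriction ñ of the quadratic xᵀ n x, so this is the identity ∇_A∇_B ñ ∇^A∇^B ñ = 20 ñ² − 8Q + (4/3) Σ_{i,j} n_{ij}² with Q = xᵀ n² x − (1/3) tr(n²), used in the computation of the quadrupole mode decomposition of the news squared.) -/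
open MeasureTheory Matrix

noncomputable section

/-- The quadratic form xᵀ n x. -/
def quadF (n : Matrix (Fin 3) (Fin 3) ℝ) (x : E3) : ℝ := ∑ i, ∑ j, n i j * x i * x j

/-- Multiplying a matrix on both sides by `x xᵀ` gives the quadratic form times `x xᵀ`. -/
theorem outer_mul_mul_outer (x : E3) (m : Matrix (Fin 3) (Fin 3) ℝ) :
    (1 - proj3 x) * m * (1 - proj3 x) = quadF m x • (1 - proj3 x) := by
  ext i j
  simp only [proj3, sub_sub_cancel, quadF, Matrix.mul_apply, Matrix.smul_apply, Matrix.of_apply,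
    Fin.sum_univ_three, smul_eq_mul]
  ring

theorem trace_proj3_mul (x : E3) (m : Matrix (Fin 3) (Fin 3) ℝ) :
    (proj3 x * m).trace = m.trace - quadF m x := by
  rw [proj3, sub_mul, one_mul, Matrix.trace_sub]
  simp only [quadF, Matrix.trace, Matrix.diag_apply, Matrix.mul_apply, Matrix.of_apply,
    Fin.sum_univ_three]
  ring

theorem quadF_one {x : E3} (hx : ‖x‖ = 1) : quadF 1 x = 1 := by
  have h := EuclideanSpace.norm_sq_eq x
  simp only [hx, Real.norm_eq_abs, sq_abs, Fin.sum_univ_three] at h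
  simp only [quadF, Matrix.one_apply, Fin.sum_univ_three]
  simp
  linarith

theorem proj3_mul_self {x : E3} (hx : ‖x‖ = 1) : proj3 x * proj3 x = proj3 x := by
  have h := outer_mul_mul_outer x 1
  rw [quadF_one hx, one_smul, mul_one, sub_mul, one_mul, mul_sub, mul_one] at h
  have h' := sub_eq_self.mp h
  exact (sub_eq_zero.mp h').symm

theorem trace_proj3_mul_mul_proj3_mul (x : E3) (m : Matrix (Fin 3) (Fin 3) ℝ) :
    (proj3 x * m * proj3 x * m).trace =
      (m * m).trace - 2 * quadF (m * m) x + quadF m x ^ 2 := by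
  have h : proj3 x * m * proj3 x * m =
      proj3 x * (m * m) - m * (1 - proj3 x) * m
        + (1 - proj3 x) * m * (1 - proj3 x) * m := by
    noncomm_ring
  have h₁ : (m * (1 - proj3 x) * m).trace = quadF (m * m) x := by
    rw [Matrix.trace_mul_cycle, Matrix.trace_mul_comm, sub_mul, one_mul, Matrix.trace_sub,
      trace_proj3_mul]
    ring
  have h₂ : ((1 - proj3 x) * m).trace = quadF m x := by
    rw [sub_mul, one_mul, Matrix.trace_sub, trace_proj3_mul]
    ring
  rw [h, outer_mul_mul_outer, Matrix.trace_add, Matrix.trace_sub, trace_proj3_mul, h₁,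
    smul_mul_assoc, Matrix.trace_smul, h₂, smul_eq_mul]
  ring

/-- for symmetric traceless n and x ∈ S²,
tr((2P n P − 2(xᵀnx)P)²) = 20(xᵀnx)² − 8(xᵀn²x − (1/3)tr(n²)) + (4/3)tr(n²). -/
theorem hessian_quadrupole_square (n : Matrix (Fin 3) (Fin 3) ℝ)
    (hsym : n.IsSymm) (htr : n.trace = 0) (x : E3) (hx : ‖x‖ = 1) :
    ((((2:ℝ) • (proj3 x * n * proj3 x) - (2 * quadF n x) • proj3 x) *
      ((2:ℝ) • (proj3 x * n * proj3 x) - (2 * quadF n x) • proj3 x)).trace) =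
      20 * (quadF n x) ^ 2 - 8 * (quadF (n * n) x - (1 / 3) * (n * n).trace)
        + (4 / 3) * (n * n).trace := by
  have hP := proj3_mul_self hx
  have hq := trace_proj3_mul_mul_proj3_mul x n
  have hn := trace_proj3_mul x n
  have h1 : (proj3 x).trace = 2 := by
    have h := trace_proj3_mul x 1
    rw [mul_one, quadF_one hx, Matrix.trace_one, Fintype.card_fin] at h
    rw [h]
    norm_num
  set P := proj3 x
  have hA : (P * n * P * (P * n * P)).trace = (P * n * P * n).trace := by
    rw [← mul_assoc, Matrix.trace_mul_comm]
    simp only [← mul_assoc, hP]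
    rw [mul_assoc (P * n) P P, hP]
  have hB : (P * n * P * P).trace = (P * n).trace := by
    rw [mul_assoc, hP, Matrix.trace_mul_comm, ← mul_assoc, hP]
  have hC : (P * (P * n * P)).trace = (P * n).trace := by
    rw [Matrix.trace_mul_comm, hB]
  simp only [sub_mul, mul_sub, smul_mul_assoc, mul_smul_comm, Matrix.trace_sub,
    Matrix.trace_smul, smul_eq_mul, hA, hB, hC, hP, hq, hn, h1, htr]
  ring
end
end
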